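/- Let N be a positive integer and B, C₁, C₂ ≥ 0 be real constants. Then there exists a real constant C, depending only on N, B, C₁, C₂, with the following property: whenever u, w : ℝ^N → ℝ are twice continuously differentiable nonnegative functions and v : ℝ^N → ℝ is a continuous nonnegative function such that (i) w(x) ≤ B for all x, (ii) Δu(x) ≥ v(x) − C₁·(u(x)+1) for all x, (iii) Δw(x) ≥ u(x) − C₂ for all x, (iv) ‖∇u(x)‖ ≤ 2·√(u(x)·v(x)) for all x, and (v) ‖∇w(x)‖ ≤ 2·√(w(x)·u(x)) for all x, then u(x) ≤ C for all x ∈ ℝ^N. -/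

import Mathlib

/-- The Euclidean Laplacian of a function `φ : ℝ^N → ℝ`:
`Δφ(x) = ∑ i, ∂²φ/∂x_i²(x)`. -/
noncomputable def euclideanLaplacian {N : ℕ} (φ : EuclideanSpace ℝ (Fin N) → ℝ)
    (x : EuclideanSpace ℝ (Fin N)) : ℝ :=
  ∑ i : Fin N, iteratedFDeriv ℝ 2 φ x ![EuclideanSpace.single i 1, EuclideanSpace.single i 1]

open Filter Topology

/-- Second derivative test, necessary condition: at a local maximum the second derivative of a
real function is nonpositive. -/
lemma IsLocalMax.second_deriv_nonpos {f f' : ℝ → ℝ} {a c : ℝ} (hmax : IsLocalMax f a)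
    (hf : ∀ᶠ t in 𝓝 a, HasDerivAt f (f' t) t) (hf' : HasDerivAt f' c a) : c ≤ 0 := by
  by_contra! hc
  have hd : deriv f =ᶠ[𝓝 a] f' := hf.mono fun t ht => ht.deriv
  have hdd : deriv (deriv f) a = c := by rw [hd.deriv_eq, hf'.deriv]
  have hmin : IsLocalMin f a := isLocalMin_of_deriv_deriv_pos (by rw [hdd]; exact hc)
    hmax.deriv_eq_zero hf.self_of_nhds.continuousAt
  have hconst : f =ᶠ[𝓝 a] fun _ => f a := by
    filter_upwards [hmax, hmin] with t h₁ h₂ using le_antisymm h₁ h₂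
  have h₀ : deriv (deriv f) a = 0 := by
    rw [hconst.deriv.deriv_eq]
    simp
  linarith

section Lines

variable {E : Type*} [NormedAddCommGroup E] [NormedSpace ℝ E]

lemma ContDiff.hasDerivAt_comp_line {φ : E → ℝ} (hφ : ContDiff ℝ 2 φ) (x e : E) (t : ℝ) :
    HasDerivAt (fun s : ℝ => φ (x + s • e)) (fderiv ℝ φ (x + t • e) e) t := by
  have hl : HasDerivAt (fun s : ℝ => x + s • e) e t := by
    simpa using ((hasDerivAt_id t).smul_const e).const_add x
  exact ((hφ.differentiable (by norm_num)) _).hasFDerivAt.comp_hasDerivAt t hl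

lemma ContDiff.hasDerivAt_fderiv_comp_line {φ : E → ℝ} (hφ : ContDiff ℝ 2 φ) (x e : E) :
    HasDerivAt (fun s : ℝ => fderiv ℝ φ (x + s • e) e) (iteratedFDeriv ℝ 2 φ x ![e, e]) 0 := by
  have hl : HasDerivAt (fun s : ℝ => x + s • e) e 0 := by
    simpa using ((hasDerivAt_id (0 : ℝ)).smul_const e).const_add x
  have hd : Differentiable ℝ (fderiv ℝ φ) :=
    (hφ.fderiv_right (m := 1) (by norm_num)).differentiable (by norm_num)
  have h := (hd (x + (0 : ℝ) • e)).hasFDerivAt.comp_hasDerivAt (0 : ℝ) hl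
  have h' := h.clm_apply (hasDerivAt_const (0 : ℝ) e)
  rw [iteratedFDeriv_two_apply]
  simpa using h'

end Lines

/-- Second order comparison along a line at an interior maximum of `u (A + w) η²`, where
`η(t) = 1 - (r + 2 b t + t²)`. -/
lemma second_deriv_le_of_cutoff_max {u u' w w' : ℝ → ℝ} {u'' w'' A r b m : ℝ}
    (hu : ∀ t, HasDerivAt u (u' t) t) (hu' : HasDerivAt u' u'' 0)
    (hw : ∀ t, HasDerivAt w (w' t) t) (hw' : HasDerivAt w' w'' 0)
    (hr : r < 1) (hm : m = (1 - r) ^ 2 * (u 0 * (A + w 0)))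
    (hmax : ∀ t, 0 < 1 - (r + 2 * b * t + t ^ 2) →
      (1 - (r + 2 * b * t + t ^ 2)) ^ 2 * (u t * (A + w t)) ≤ m) :
    (1 - r) ^ 4 * (u'' * (A + w 0) + 2 * (u' 0 * w' 0) + u 0 * w'') ≤
      m * (24 * b ^ 2 + 4 * (1 - r)) := by
  set η : ℝ → ℝ := fun t => 1 - (r + 2 * b * t + t ^ 2) with hη
  have hη0 : η 0 = 1 - r := by simp [hη]
  have hηd : ∀ t, HasDerivAt η (-(2 * b + 2 * t)) t := by
    intro t
    have h := ((((hasDerivAt_id t).const_mul (2 * b)).const_add r).add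
      ((hasDerivAt_id t).pow 2)).const_sub 1
    refine h.congr_deriv ?_
    simp
  have hpos : ∀ᶠ t in 𝓝 (0 : ℝ), 0 < η t :=
    (hηd 0).continuousAt.eventually (lt_mem_nhds (by rw [hη0]; linarith))
  have hne : 1 - r ≠ 0 := by linarith
  have hmaxl : IsLocalMax (fun t => u t * (A + w t) - m * (η t ^ 2)⁻¹) 0 := by
    filter_upwards [hpos] with t ht
    have h1 : u t * (A + w t) ≤ m * (η t ^ 2)⁻¹ := by
      rw [← div_eq_mul_inv, le_div_iff₀ (by positivity), mul_comm]
      exact hmax t ht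
    have h2 : u 0 * (A + w 0) = m * (η 0 ^ 2)⁻¹ := by
      rw [hη0, hm]; field_simp
    linarith
  have hd1 : ∀ᶠ t in 𝓝 (0 : ℝ), HasDerivAt (fun t => u t * (A + w t) - m * (η t ^ 2)⁻¹)
      (u' t * (A + w t) + u t * w' t - m * (2 * (2 * b + 2 * t) * (η t ^ 3)⁻¹)) t := by
    filter_upwards [hpos] with t ht
    have h := ((hu t).mul ((hw t).const_add A)).sub
      ((((hηd t).pow 2).inv (pow_ne_zero 2 ht.ne')).const_mul m)
    refine h.congr_deriv ?_
    simp only [Pi.pow_apply]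
    field_simp
    ring
  have hη0' : η 0 ≠ 0 := by rw [hη0]; exact hne
  have hlin : HasDerivAt (fun t : ℝ => 2 * (2 * b + 2 * t)) 4 0 := by
    refine ((((hasDerivAt_id (0 : ℝ)).const_mul 2).const_add (2 * b)).const_mul 2).congr_deriv ?_
    norm_num
  have hd2 : HasDerivAt
      (fun t => u' t * (A + w t) + u t * w' t - m * (2 * (2 * b + 2 * t) * (η t ^ 3)⁻¹))
      (u'' * (A + w 0) + 2 * (u' 0 * w' 0) + u 0 * w''
        - m * (24 * b ^ 2 + 4 * (1 - r)) / (1 - r) ^ 4) 0 := by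
    have h := ((hu'.mul ((hw 0).const_add A)).add ((hu 0).mul hw')).sub
      ((hlin.mul (((hηd 0).pow 3).inv (pow_ne_zero 3 hη0'))).const_mul m)
    refine h.congr_deriv ?_
    simp only [Pi.pow_apply, Pi.inv_apply, hη0]
    field_simp
    ring
  have key := hmaxl.second_deriv_nonpos hd1 hd2
  have h4 : 0 < (1 - r) ^ 4 := pow_pos (by linarith) 4
  rw [mul_comm, ← le_div_iff₀ h4]
  linarith

/-- The algebraic estimate at the maximum point: `s` is the cutoff, `p` the inner product of the
gradients, `L` and `W` the Laplacians of `u` and `w`. -/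
lemma bound_of_cutoff_inequality {B C₁ C₂ R s u v w L W p : ℝ} (hC₁ : 0 ≤ C₁)
    (hC₂ : 0 ≤ C₂) (hR : 0 ≤ R) (hs0 : 0 ≤ s) (hs1 : s ≤ 1) (hu : 0 ≤ u) (hv : 0 ≤ v)
    (hw : 0 ≤ w) (hwB : w ≤ B) (hL : v - C₁ * (u + 1) ≤ L) (hW : u - C₂ ≤ W)
    (hp : -(2 * √(u * v) * (2 * √(w * u))) ≤ p)
    (hmain : s ^ 4 * (L * (32 * B + 1 + w) + 2 * p + u * W) ≤
      s ^ 2 * (u * (32 * B + 1 + w)) * R) :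
    s ^ 2 * (u * (32 * B + 1 + w)) ≤ (33 * B + 1) * (2 * ((33 * B + 1) * R +
      2 * ((33 * B + 1) * C₁ + C₂)) + 1) := by
  have hB : 0 ≤ B := hw.trans hwB
  set D := 33 * B + 1 with hD
  set K := D * C₁ + C₂ with hK
  have hD0 : 0 ≤ D := by positivity
  have hK0 : 0 ≤ K := by positivity
  have hsq : √(u * v) * √(w * u) = u * √(v * w) := by
    rw [← Real.sqrt_mul (by positivity), show u * v * (w * u) = u ^ 2 * (v * w) by ring,
      Real.sqrt_mul (by positivity), Real.sqrt_sq hu]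
  have hq : √(v * w) ^ 2 = v * w := Real.sq_sqrt (by positivity)
  have hcross : -(u ^ 2 / 2 + 32 * (v * w)) ≤ 2 * p := by
    nlinarith [sq_nonneg (u - 8 * √(v * w))]
  have hvw : v * w ≤ v * B := mul_le_mul_of_nonneg_left hwB hv
  have hLA : (v - C₁ * (u + 1)) * (32 * B + 1 + w) ≤ L * (32 * B + 1 + w) :=
    mul_le_mul_of_nonneg_right hL (by positivity)
  have hC₁D : C₁ * (u + 1) * (32 * B + 1 + w) ≤ C₁ * (u + 1) * D :=
    mul_le_mul_of_nonneg_left (by linarith) (by positivity)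
  have hWu : u * (u - C₂) ≤ u * W := mul_le_mul_of_nonneg_left hW hu
  have hvw0 : 0 ≤ v * w := by positivity
  have hlow : u ^ 2 / 2 - K * (u + 1) ≤ L * (32 * B + 1 + w) + 2 * p + u * W := by
    linarith
  have hs2 : s ^ 2 ≤ 1 := by nlinarith
  have hs4 : s ^ 4 ≤ s ^ 2 := by nlinarith [sq_nonneg s]
  set U := s ^ 2 * u with hU
  have hU0 : 0 ≤ U := by positivity
  have hm : s ^ 2 * (u * (32 * B + 1 + w)) ≤ D * U := by
    have : U * (32 * B + 1 + w) ≤ U * D := mul_le_mul_of_nonneg_left (by linarith) hU0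
    linarith
  have hmR : s ^ 2 * (u * (32 * B + 1 + w)) * R ≤ D * U * R :=
    mul_le_mul_of_nonneg_right hm hR
  have hlow' := mul_le_mul_of_nonneg_left hlow (show 0 ≤ s ^ 4 by positivity)
  have hKu : K * (s ^ 4 * (u + 1)) ≤ K * (U + 1) := by
    refine mul_le_mul_of_nonneg_left ?_ hK0
    have : s ^ 4 * u ≤ s ^ 2 * u := mul_le_mul_of_nonneg_right hs4 hu
    rw [hU]; linarith
  have hfin : U ^ 2 / 2 ≤ D * U * R + K * (U + 1) := by
    have : U ^ 2 / 2 = s ^ 4 * (u ^ 2 / 2) := by rw [hU]; ring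
    linarith
  have hUle : U ≤ 2 * (D * R + 2 * K) + 1 := by
    by_contra! hlt
    have hDR : 0 ≤ D * R := by positivity
    have h1 : 1 ≤ U := by linarith
    have h2 := mul_le_mul_of_nonneg_left h1 hK0
    have h3 := mul_lt_mul_of_pos_left hlt (zero_lt_one.trans_le h1)
    linarith
  exact hm.trans (mul_le_mul_of_nonneg_left hUle hD0)

lemma fderiv_single_eq_gradient {N : ℕ} {φ : EuclideanSpace ℝ (Fin N) → ℝ}
    (x : EuclideanSpace ℝ (Fin N)) (i : Fin N) :
    fderiv ℝ φ x (EuclideanSpace.single i 1) = gradient φ x i := by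
  have h : fderiv ℝ φ x (EuclideanSpace.single i 1) =
      inner ℝ (gradient φ x) (EuclideanSpace.single i 1) := by
    simp [gradient]
  rw [h, EuclideanSpace.inner_single_right]
  simp

lemma norm_add_smul_single_sq {N : ℕ} (y : EuclideanSpace ℝ (Fin N)) (i : Fin N) (t : ℝ) :
    ‖y + t • EuclideanSpace.single i (1 : ℝ)‖ ^ 2 = ‖y‖ ^ 2 + 2 * y i * t + t ^ 2 := by
  rw [norm_add_sq_real, inner_smul_right, EuclideanSpace.inner_single_right, norm_smul]
  simp
  ring

/-- Interior maximum of `(1 - ‖x - x₀‖²)² u (A + w)`: the Leibniz expansion of the Laplacian of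
`u (A + w)` is controlled by the maximal value. -/
lemma laplacian_le_of_cutoff_max {N : ℕ} {u w : EuclideanSpace ℝ (Fin N) → ℝ} {A m : ℝ}
    (hu : ContDiff ℝ 2 u) (hw : ContDiff ℝ 2 w) {x₀ x : EuclideanSpace ℝ (Fin N)}
    (hx : ‖x - x₀‖ ^ 2 < 1) (hm : m = (1 - ‖x - x₀‖ ^ 2) ^ 2 * (u x * (A + w x))) (hm0 : 0 ≤ m)
    (hmax : ∀ z, 0 < 1 - ‖z - x₀‖ ^ 2 → (1 - ‖z - x₀‖ ^ 2) ^ 2 * (u z * (A + w z)) ≤ m) :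
    (1 - ‖x - x₀‖ ^ 2) ^ 4 * (euclideanLaplacian u x * (A + w x) +
      2 * inner ℝ (gradient u x) (gradient w x) + u x * euclideanLaplacian w x) ≤
        m * (24 + 4 * N) := by
  have hi : ∀ i : Fin N, (1 - ‖x - x₀‖ ^ 2) ^ 4 *
      (iteratedFDeriv ℝ 2 u x ![EuclideanSpace.single i 1, EuclideanSpace.single i 1] * (A + w x)
        + 2 * (gradient u x i * gradient w x i) + u x *
        iteratedFDeriv ℝ 2 w x ![EuclideanSpace.single i 1, EuclideanSpace.single i 1]) ≤
      m * (24 * (x - x₀) i ^ 2 + 4 * (1 - ‖x - x₀‖ ^ 2)) := by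
    intro i
    have key := second_deriv_le_of_cutoff_max (A := A) (r := ‖x - x₀‖ ^ 2) (b := (x - x₀) i)
      (m := m) (hu.hasDerivAt_comp_line x (EuclideanSpace.single i 1))
      (hu.hasDerivAt_fderiv_comp_line x (EuclideanSpace.single i 1))
      (hw.hasDerivAt_comp_line x (EuclideanSpace.single i 1))
      (hw.hasDerivAt_fderiv_comp_line x (EuclideanSpace.single i 1)) hx (by simpa using hm)
      (by
        intro t ht
        rw [← norm_add_smul_single_sq, sub_add_eq_add_sub] at ht ⊢
        exact hmax _ ht)
    simpa [fderiv_single_eq_gradient] using key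
  have hsum := Finset.sum_le_sum fun i (_ : i ∈ Finset.univ) => hi i
  rw [← Finset.mul_sum, ← Finset.mul_sum, Finset.sum_add_distrib, Finset.sum_add_distrib,
    Finset.sum_add_distrib, ← Finset.sum_mul, ← Finset.mul_sum, ← Finset.mul_sum,
    ← Finset.mul_sum, ← EuclideanSpace.real_norm_sq_eq] at hsum
  have hinner : inner ℝ (gradient u x) (gradient w x) =
      ∑ i, gradient u x i * gradient w x i := by
    simp only [PiLp.inner_apply]
    exact Finset.sum_congr rfl fun i _ => by simp [mul_comm]
  rw [hinner]
  refine hsum.trans (mul_le_mul_of_nonneg_left ?_ hm0)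
  simp only [Finset.sum_const, Finset.card_univ, Fintype.card_fin, nsmul_eq_mul]
  have hN : (0 : ℝ) ≤ N := N.cast_nonneg
  nlinarith [mul_nonneg hN (sq_nonneg ‖x - x₀‖)]

/-- Flat-space abstraction of the induction step in the proof of Theorem 1.4:
given `w ≤ B`, `Δu ≥ v − C₁(u+1)`, `Δw ≥ u − C₂`, `‖∇u‖ ≤ 2√(u·v)` and
`‖∇w‖ ≤ 2√(w·u)` for nonnegative functions `u, w` (C²) and `v` (continuous),
there is a bound `u ≤ C` with `C = C(N, B, C₁, C₂)`. -/
theorem stmt_5 (N : ℕ) (hN : 0 < N) (B C₁ C₂ : ℝ) (hB : 0 ≤ B) (hC₁ : 0 ≤ C₁) (hC₂ : 0 ≤ C₂) :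
    ∃ C : ℝ, ∀ u w v : EuclideanSpace ℝ (Fin N) → ℝ,
      ContDiff ℝ 2 u → ContDiff ℝ 2 w → Continuous v →
      (∀ x, 0 ≤ u x) → (∀ x, 0 ≤ w x) → (∀ x, 0 ≤ v x) →
      (∀ x, w x ≤ B) →
      (∀ x, v x - C₁ * (u x + 1) ≤ euclideanLaplacian u x) →
      (∀ x, u x - C₂ ≤ euclideanLaplacian w x) →
      (∀ x, ‖gradient u x‖ ≤ 2 * Real.sqrt (u x * v x)) →
      (∀ x, ‖gradient w x‖ ≤ 2 * Real.sqrt (w x * u x)) →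
      ∀ x, u x ≤ C := by
  refine ⟨(33 * B + 1) * (2 * ((33 * B + 1) * (24 + 4 * N) +
    2 * ((33 * B + 1) * C₁ + C₂)) + 1), ?_⟩
  intro u w v hu hw _ hu0 hw0 hv0 hwB hLu hLw hgu hgw x₀
  set F : EuclideanSpace ℝ (Fin N) → ℝ := fun z =>
    (1 - ‖z - x₀‖ ^ 2) ^ 2 * (u z * (32 * B + 1 + w z)) with hF
  have hFc : Continuous F := by
    have := hu.continuous
    have := hw.continuous
    fun_prop
  obtain ⟨x, hxball, hxmax⟩ := (isCompact_closedBall x₀ 1).exists_isMaxOn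
    ⟨x₀, Metric.mem_closedBall_self zero_le_one⟩ hFc.continuousOn
  have hA0 : ∀ z, 0 ≤ 32 * B + 1 + w z := fun z => by linarith [hw0 z]
  have hm0 : 0 ≤ F x := mul_nonneg (sq_nonneg _) (mul_nonneg (hu0 x) (hA0 x))
  have hux₀ : u x₀ ≤ F x := by
    have h := hxmax (Metric.mem_closedBall_self zero_le_one)
    have h' : F x₀ = u x₀ * (32 * B + 1 + w x₀) := by simp [hF]
    have h'' : F x₀ ≤ F x := h
    nlinarith [hu0 x₀, hw0 x₀, mul_nonneg (hu0 x₀) (hw0 x₀), mul_nonneg (hu0 x₀) hB]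
  refine hux₀.trans ?_
  have hx1 : ‖x - x₀‖ ≤ 1 := by simpa [dist_eq_norm] using hxball
  have hsq1 : ‖x - x₀‖ ^ 2 ≤ 1 := by nlinarith [norm_nonneg (x - x₀)]
  rcases hsq1.eq_or_lt with hbd | hint
  · have : F x = 0 := by simp [hF, hbd]
    rw [this]
    positivity
  have hmain := laplacian_le_of_cutoff_max (A := 32 * B + 1) hu hw hint rfl hm0 (by
    intro z hz
    refine hxmax (?_ : z ∈ Metric.closedBall x₀ 1)
    rw [mem_closedBall_iff_norm]
    nlinarith [norm_nonneg (z - x₀)])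
  refine bound_of_cutoff_inequality hC₁ hC₂ (by positivity) (by linarith)
    (by linarith [sq_nonneg ‖x - x₀‖]) (hu0 x) (hv0 x) (hw0 x) (hwB x) (hLu x) (hLw x) ?_ hmain
  have hcs := neg_le_of_abs_le (abs_real_inner_le_norm (gradient u x) (gradient w x))
  have hprod := mul_le_mul (hgu x) (hgw x) (norm_nonneg _) (by positivity)
  linarith
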